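/- Let K be a separable metric space, let U_1, U_2, … be pairwise disjoint non-empty open subsets of K with U = ⋃_{j=1}^∞ U_j, let λ < ∞, and let f : K → ℝ be a function vanishing off U such that ‖f|_{U_j}‖_{D(U_j)} ≤ λ for every j. Then f ∈ DBSC(K) and ‖f‖_D ≤ λ. -/

import Mathlib

open Filter Topology Set

noncomputable section

/-- A real-valued function is bounded. -/
def BddFun {X : Type*} (f : X → ℝ) : Prop := ∃ C, ∀ x, |f x| ≤ C

/-- `f ∈ DBSC(X)`: `f` is a difference of bounded lower semicontinuous functions. -/
def MemDBSC {X : Type*} [TopologicalSpace X] (f : X → ℝ) : Prop :=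
  ∃ u v : X → ℝ, BddFun u ∧ BddFun v ∧ LowerSemicontinuous u ∧ LowerSemicontinuous v ∧
    f = u - v

/-- The D-norm of `f`. -/
def DNorm {X : Type*} [TopologicalSpace X] (f : X → ℝ) : ℝ :=
  sInf {c | ∃ φ : ℕ → X → ℝ, (∀ j, Continuous (φ j)) ∧ (∀ x, Summable fun j => |φ j x|) ∧
    (∀ x, ∑' j, φ j x = f x) ∧ (∀ x, ∑' j, |φ j x| ≤ c)}

/-- The sup-norm of `f`. -/
def supNorm {X : Type*} (f : X → ℝ) : ℝ := ⨆ x, |f x|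

/-- A simple D-function: a D-function taking finitely many values. -/
def SimpleD {X : Type*} [TopologicalSpace X] (f : X → ℝ) : Prop :=
  MemDBSC f ∧ (Set.range f).Finite

/-- `f ∈ SD(X)`: `f` is a strong D-function. -/
def MemSD {X : Type*} [TopologicalSpace X] (f : X → ℝ) : Prop :=
  ∃ φ : ℕ → X → ℝ, (∀ n, SimpleD (φ n)) ∧
    Tendsto (fun n => DNorm (f - φ n)) atTop (𝓝 0)

/-- `f ∈ B_{1/2}(X)`: `f` is a uniform limit of D-functions. -/
def MemBHalf {X : Type*} [TopologicalSpace X] (f : X → ℝ) : Prop :=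
  ∃ g : ℕ → X → ℝ, (∀ n, MemDBSC (g n)) ∧ TendstoUniformly g f atTop

/-- The upper semicontinuous envelope `Uf`. -/
def uEnv {X : Type*} [TopologicalSpace X] (f : X → ℝ) (x : X) : ℝ :=
  sInf {c | ∃ V : Set X, IsOpen V ∧ x ∈ V ∧ sSup (f '' V) = c}

/-- The lower oscillation of `f` at `x`. -/
def losc {X : Type*} [TopologicalSpace X] (f : X → ℝ) (x : X) : ℝ :=
  sInf {c | ∃ V : Set X, IsOpen V ∧ x ∈ V ∧ sSup ((fun y => |f y - f x|) '' V) = c}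

/-- The oscillation of `f`: `osc f = U (losc f)`. -/
def osc {X : Type*} [TopologicalSpace X] (f : X → ℝ) : X → ℝ := uEnv (losc f)

/-- The oscillation sets `os_n(f, ε)`. -/
def osSet {X : Type*} [TopologicalSpace X] (f : X → ℝ) (ε : ℝ) : ℕ → Set X
  | 0 => Set.univ
  | n + 1 => {x | ∃ h : x ∈ osSet f ε n, ε ≤ osc ((osSet f ε n).restrict f) ⟨x, h⟩}

/-- The `ε`-oscillation index `i(f, ε) = sup {n : os_n(f,ε) ≠ ∅}`. -/
def oscIndex {X : Type*} [TopologicalSpace X] (f : X → ℝ) (ε : ℝ) : ℕ∞ :=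
  ⨆ (m : ℕ) (_ : (osSet f ε m).Nonempty), (m : ℕ∞)

/-- `f` has finite Baire index. -/
def FiniteBaireIndex {X : Type*} [TopologicalSpace X] (f : X → ℝ) : Prop :=
  ∃ n : ℕ, ∀ ε > 0, osSet f ε n = ∅

/-- The Baire index `i(f) = sup_{ε > 0} i(f, ε)`. -/
def baireIndex {X : Type*} [TopologicalSpace X] (f : X → ℝ) : ℕ∞ :=
  ⨆ (ε : ℝ) (_ : 0 < ε), oscIndex f ε

open scoped ENNReal

/-- `f` is the pointwise sum of a sequence of continuous functions whose absolute values sum to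
at most `c` everywhere. -/
def DBound {X : Type*} [TopologicalSpace X] (f : X → ℝ) (c : ℝ) : Prop :=
  ∃ φ : ℕ → X → ℝ, (∀ j, Continuous (φ j)) ∧ (∀ x, Summable fun j => |φ j x|) ∧
    (∀ x, ∑' j, φ j x = f x) ∧ (∀ x, ∑' j, |φ j x| ≤ c)

section DBound

variable {X : Type*} [TopologicalSpace X] {f g : X → ℝ} {c c' : ℝ}

lemma DBound.nonneg [Nonempty X] (h : DBound f c) : 0 ≤ c := by
  obtain ⟨φ, -, -, -, hc⟩ := h
  exact (tsum_nonneg fun j => abs_nonneg (φ j (Classical.arbitrary X))).trans (hc _)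

lemma DBound.dNorm_le [Nonempty X] (h : DBound f c) : DNorm f ≤ c :=
  csInf_le ⟨0, fun _ hb => DBound.nonneg hb⟩ h

lemma DBound.of_dNorm_lt (h : DBound f c) (hlt : DNorm f < c') : DBound f c' := by
  obtain ⟨b, ⟨φ, hφ, hs, hsum, hb⟩, hbc⟩ :=
    exists_lt_of_csInf_lt (s := {c | DBound f c}) ⟨c, h⟩ hlt
  exact ⟨φ, hφ, hs, hsum, fun x => (hb x).trans hbc.le⟩

lemma DBound.sub (hf : DBound f c) (hg : DBound g c') : DBound (f - g) (c + c') := by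
  obtain ⟨φ, hφ, hs, hsum, hb⟩ := hf
  obtain ⟨ψ, hψ, hs', hsum', hb'⟩ := hg
  have habs (x : X) : Summable fun j => |φ j x - ψ j x| :=
    ((hs x).add (hs' x)).of_nonneg_of_le (fun _ => abs_nonneg _) fun _ => abs_sub _ _
  refine ⟨fun j x => φ j x - ψ j x, fun j => (hφ j).sub (hψ j), habs, fun x => ?_, fun x => ?_⟩
  · rw [(hs x).of_abs.tsum_sub (hs' x).of_abs, hsum, hsum', Pi.sub_apply]
  · calc ∑' j, |φ j x - ψ j x| ≤ ∑' j, (|φ j x| + |ψ j x|) :=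
          (habs x).tsum_le_tsum (fun _ => abs_sub _ _) ((hs x).add (hs' x))
      _ = ∑' j, |φ j x| + ∑' j, |ψ j x| := (hs x).tsum_add (hs' x)
      _ ≤ c + c' := add_le_add (hb x) (hb' x)

lemma DBound.of_hasSum {ι : Type*} [Denumerable ι] (φ : ι → X → ℝ) (hφ : ∀ i, Continuous (φ i))
    (hsum : ∀ x, HasSum (fun i => φ i x) (f x))
    (habs : ∀ x, ∃ s ≤ c, HasSum (fun i => |φ i x|) s) : DBound f c := by
  let e : ℕ ≃ ι := (Denumerable.eqv ι).symm
  refine ⟨fun n => φ (e n), fun n => hφ _, fun x => ?_, fun x => ?_, fun x => ?_⟩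
  · obtain ⟨s, -, hs⟩ := habs x
    exact (e.hasSum_iff.2 hs).summable
  · exact (e.hasSum_iff.2 (hsum x)).tsum_eq
  · obtain ⟨s, hsc, hs⟩ := habs x
    exact (e.hasSum_iff.2 hs).tsum_eq.trans_le hsc

lemma lowerSemicontinuous_tsum_of_nonneg {φ : ℕ → X → ℝ} (hφ : ∀ j, Continuous (φ j))
    (h0 : ∀ j x, 0 ≤ φ j x) (hs : ∀ x, Summable fun j => φ j x) :
    LowerSemicontinuous fun x => ∑' j, φ j x := by
  intro x y hy
  obtain ⟨n, hn⟩ := ((hs x).hasSum.tendsto_sum_nat.eventually_const_lt hy).exists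
  have hcont : Continuous fun z => ∑ j ∈ Finset.range n, φ j z :=
    continuous_finsetSum _ fun j _ => hφ j
  filter_upwards [hcont.continuousAt.eventually_const_lt hn] with z hz
  exact hz.trans_le ((hs z).sum_le_tsum _ fun j _ => h0 j z)

lemma DBound.memDBSC (h : DBound f c) : MemDBSC f := by
  obtain ⟨φ, hφ, hs, hsum, hb⟩ := h
  have key (ε : ℝ) (hε : |ε| = 1) :
      (∀ x, Summable fun j => max (ε * φ j x) 0) ∧ BddFun (fun x => ∑' j, max (ε * φ j x) 0) ∧
        LowerSemicontinuous fun x => ∑' j, max (ε * φ j x) 0 := by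
    have hle (j : ℕ) (x : X) : max (ε * φ j x) 0 ≤ |φ j x| :=
      max_le ((le_abs_self _).trans (by rw [abs_mul, hε, one_mul])) (abs_nonneg _)
    have hsm (x : X) : Summable fun j => max (ε * φ j x) 0 :=
      (hs x).of_nonneg_of_le (fun _ => le_max_right _ _) fun j => hle j x
    refine ⟨hsm, ⟨c, fun x => ?_⟩, lowerSemicontinuous_tsum_of_nonneg
      (fun j => (continuous_const.mul (hφ j)).max continuous_const)
      (fun _ _ => le_max_right _ _) hsm⟩
    rw [abs_of_nonneg (tsum_nonneg fun _ => le_max_right _ _)]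
    exact ((hsm x).tsum_le_tsum (fun j => hle j x) (hs x)).trans (hb x)
  obtain ⟨hs₁, hb₁, hl₁⟩ := key 1 (by simp)
  obtain ⟨hs₂, hb₂, hl₂⟩ := key (-1) (by simp)
  refine ⟨_, _, hb₁, hb₂, hl₁, hl₂, funext fun x => ?_⟩
  rw [Pi.sub_apply, ← (hs₁ x).tsum_sub (hs₂ x), ← hsum x]
  congr 1 with j
  rcases le_total 0 (φ j x) with h | h <;> simp [h]

end DBound

/-- A nonnegative lower semicontinuous function on a metric space is the limit of an increasing
sequence of continuous functions starting at `0`. -/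
lemma LowerSemicontinuous.exists_monotone_continuous_tendsto {X : Type*} [MetricSpace X]
    {u : X → ℝ} (hu : LowerSemicontinuous u) (h0 : ∀ x, 0 ≤ u x) :
    ∃ s : ℕ → X → ℝ, (∀ n, Continuous (s n)) ∧ (∀ x, Monotone fun n => s n x) ∧
      (∀ x, s 0 x = 0) ∧ ∀ x, Tendsto (fun n => s n x) atTop (𝓝 (u x)) := by
  let k (n : ℕ) (x y : X) : ℝ := min n (u y + n * dist x y)
  have hk (n : ℕ) (x y : X) : 0 ≤ k n x y :=
    le_min n.cast_nonneg (add_nonneg (h0 y) (by positivity))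
  have hbdd (n : ℕ) (x : X) : BddBelow (range (k n x)) := ⟨0, by rintro _ ⟨y, rfl⟩; exact hk n x y⟩
  refine ⟨fun n x => ⨅ y, k n x y, fun n => ?_, fun x m n hmn => ?_, fun x => ?_, fun x => ?_⟩
  · refine (LipschitzWith.of_le_add_mul n fun x x' => ?_).continuous
    have : Nonempty X := ⟨x⟩
    rw [← sub_le_iff_le_add]
    refine le_ciInf fun y => ?_
    rw [sub_le_iff_le_add]
    refine (ciInf_le (hbdd n x) y).trans ?_
    have hd : (0 : ℝ) ≤ n * dist x x' := by positivity
    have ht : (n : ℝ) * dist x y ≤ n * dist x x' + n * dist x' y := by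
      rw [← mul_add]
      exact mul_le_mul_of_nonneg_left (dist_triangle _ _ _) n.cast_nonneg
    simp only [k, NNReal.coe_natCast]
    rw [← min_add_add_right]
    exact min_le_min (by linarith) (by linarith)
  · exact ciInf_mono (hbdd m x) fun y => min_le_min (by exact_mod_cast hmn) (by gcongr)
  · have : Nonempty X := ⟨x⟩
    have hk0 (y : X) : k 0 x y = 0 := by simp [k, h0]
    simp [hk0]
  · have : Nonempty X := ⟨x⟩
    refine tendsto_order.2 ⟨fun a ha => ?_, fun a ha => Eventually.of_forall fun n => ?_⟩
    · obtain ⟨b, hab, hb⟩ := exists_between ha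
      obtain ⟨δ, hδ, hball⟩ := Metric.eventually_nhds_iff.1 (hu x b hb)
      filter_upwards [tendsto_natCast_atTop_atTop.eventually_ge_atTop b,
        tendsto_natCast_atTop_atTop.eventually_ge_atTop (b / δ)] with n hn hn'
      refine hab.trans_le (le_ciInf fun y => le_min hn ?_)
      rcases lt_or_ge (dist x y) δ with h | h
      · have := hball (dist_comm x y ▸ h)
        have : (0 : ℝ) ≤ n * dist x y := by positivity
        linarith
      · have : b ≤ n * δ := (div_le_iff₀ hδ).1 hn'
        have : (n : ℝ) * δ ≤ n * dist x y := by gcongr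
        linarith [h0 y]
    · refine lt_of_le_of_lt ((ciInf_le (hbdd n x) x).trans ?_) ha
      simp [k]

lemma LowerSemicontinuous.dBound {X : Type*} [MetricSpace X] {u : X → ℝ} {C : ℝ}
    (hu : LowerSemicontinuous u) (h0 : ∀ x, 0 ≤ u x) (hC : ∀ x, u x ≤ C) : DBound u C := by
  obtain ⟨s, hs, hmono, hs0, hlim⟩ := hu.exists_monotone_continuous_tendsto h0
  have hnn (n : ℕ) (x : X) : 0 ≤ s (n + 1) x - s n x := sub_nonneg.2 (hmono x n.le_succ)
  have hsum (x : X) : HasSum (fun n => s (n + 1) x - s n x) (u x) := by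
    rw [hasSum_iff_tendsto_nat_of_nonneg fun n => hnn n x]
    simpa [Finset.sum_range_sub (fun n => s n x), hs0] using hlim x
  exact .of_hasSum (fun n x => s (n + 1) x - s n x) (fun n => (hs _).sub (hs _)) hsum
    fun x => ⟨u x, hC x, by simpa only [abs_of_nonneg (hnn _ x)] using hsum x⟩

lemma MemDBSC.exists_dBound {X : Type*} [MetricSpace X] {f : X → ℝ} (h : MemDBSC f) :
    ∃ c, DBound f c := by
  obtain ⟨u, v, ⟨A, hA⟩, ⟨B, hB⟩, hu, hv, rfl⟩ := h
  have shift {w : X → ℝ} (hw : LowerSemicontinuous w) (hC : ∀ x, |w x| ≤ max A B) :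
      DBound (fun x => w x + max A B) (max A B + max A B) :=
    (hw.add continuous_const.lowerSemicontinuous).dBound
      (fun x => by linarith [neg_le_of_abs_le (hC x)])
      (fun x => by linarith [le_of_abs_le (hC x)])
  have := (shift hu fun x => (hA x).trans (le_max_left _ _)).sub
    (shift hv fun x => (hB x).trans (le_max_right _ _))
  refine ⟨max A B + max A B + (max A B + max A B), ?_⟩
  convert this using 1
  ext x
  simp

/-- Multiplying a bounded continuous function on an open set `U` by a continuous function that
vanishes off `U` gives a continuous function. -/
lemma continuous_mul_extend_zero {K : Type*} [TopologicalSpace K] {U : Set K} (hU : IsOpen U)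
    {w : K → ℝ} (hw : Continuous w) (hw0 : ∀ x ∉ U, w x = 0) {φ : U → ℝ} (hφ : Continuous φ)
    {C : ℝ} (hC : ∀ x, |φ x| ≤ C) :
    Continuous fun x => w x * Function.extend Subtype.val φ 0 x := by
  rw [continuous_iff_continuousAt]
  intro x
  by_cases hx : x ∈ U
  · refine hw.continuousAt.mul ?_
    rw [← hU.isOpenEmbedding_subtypeVal.continuousAt_iff (x := ⟨x, hx⟩),
      Function.extend_comp Subtype.val_injective]
    exact hφ.continuousAt
  · have hle (y : K) : ‖w y * Function.extend Subtype.val φ 0 y‖ ≤ |w y| * |C| := by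
      rw [norm_mul]
      refine mul_le_mul_of_nonneg_left ?_ (abs_nonneg _)
      by_cases hy : y ∈ U
      · exact (congrArg _ (Subtype.val_injective.extend_apply φ 0 ⟨y, hy⟩)).trans_le
          ((hC ⟨y, hy⟩).trans (le_abs_self C))
      · rw [Function.extend_apply' _ _ _ (by simpa using hy)]
        simp
    rw [ContinuousAt, hw0 x hx, zero_mul]
    refine squeeze_zero_norm hle ?_
    have : Tendsto (fun y => |w y| * |C|) (𝓝 x) (𝓝 (|w x| * |C|)) :=
      (hw.abs.mul continuous_const).tendsto x
    simpa [hw0 x hx] using this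

/-- An open set `U` of a metric space carries a sequence of nonnegative continuous functions that
vanish off `U` and sum to `1` on `U`: take `d * (1 - d) ^ m`, where `d` is a continuous function
with values in `[0, 1]` whose zero set is the complement of `U`. -/
lemma IsOpen.exists_continuous_hasSum_one {K : Type*} [MetricSpace K] {U : Set K}
    (hU : IsOpen U) : ∃ w : ℕ → K → ℝ, (∀ m, Continuous (w m)) ∧ (∀ m x, 0 ≤ w m x) ∧
      (∀ m, ∀ x ∉ U, w m x = 0) ∧ ∀ x ∈ U, HasSum (fun m => w m x) 1 := by
  obtain ⟨d, hd0, hd⟩ := perfectlyNormalSpace_iff_forall_isClosed_preimage_zero.1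
    inferInstance Uᶜ hU.isClosed_compl
  replace hd0 (x : K) : d x = 0 ↔ x ∉ U := by
    rw [← mem_compl_iff, hd0]; rfl
  refine ⟨fun m x => d x * (1 - d x) ^ m, fun m => by fun_prop, fun m x =>
    mul_nonneg (hd x).1 (pow_nonneg (sub_nonneg.2 (hd x).2) m), fun m x hx => ?_, fun x hx => ?_⟩
  · simp [(hd0 x).2 hx]
  · have hne : d x ≠ 0 := fun h => (hd0 x).1 h hx
    have := (hasSum_geometric_of_lt_one (sub_nonneg.2 (hd x).2)
      (sub_lt_self 1 ((hd x).1.lt_of_ne' hne))).mul_left (d x)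
    rwa [sub_sub_cancel, mul_inv_cancel₀ hne] at this

lemma HasSum.mul_prod_of_sum_one {a b : ℕ → ℝ} (ha : HasSum a 1) (ha0 : ∀ m, 0 ≤ a m)
    (hb : Summable fun n => |b n|) :
    HasSum (fun q : ℕ × ℕ => a q.1 * b q.2) (∑' n, b n) ∧
      HasSum (fun q : ℕ × ℕ => |a q.1 * b q.2|) (∑' n, |b n|) := by
  have hs := ha.summable.mul_of_nonneg hb ha0 fun n => abs_nonneg (b n)
  have habs (q : ℕ × ℕ) : |a q.1 * b q.2| = a q.1 * |b q.2| := by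
    rw [abs_mul, abs_of_nonneg (ha0 _)]
  constructor
  · have := ha.mul hb.of_abs.hasSum (Summable.of_abs (by simpa only [habs] using hs))
    rwa [one_mul] at this
  · have := ha.mul hb.hasSum hs
    rw [one_mul] at this
    simpa only [habs] using this

/-- The bound localizes to a sequence of disjoint open sets. -/
lemma DBound.of_restrict {K : Type*} [MetricSpace K] {U : ℕ → Set K} (hopen : ∀ j, IsOpen (U j))
    (hdisj : Pairwise fun i j => Disjoint (U i) (U j)) {c : ℝ} (hc : 0 ≤ c) {f : K → ℝ}
    (hsupp : ∀ x, x ∉ (⋃ j, U j) → f x = 0) (hf : ∀ j, DBound (fun x : U j => f x) c) :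
    DBound f c := by
  choose φ hφ hs hsum hb using hf
  choose w hw hwnn hw0 hw1 using fun j => (hopen j).exists_continuous_hasSum_one
  have hle (j n : ℕ) (x : U j) : |φ j n x| ≤ c :=
    ((hs j x).le_tsum n fun _ _ => abs_nonneg _).trans (hb j x)
  let Φ (p : ℕ × ℕ × ℕ) (x : K) : ℝ :=
    w p.1 p.2.1 x * Function.extend Subtype.val (φ p.1 p.2.2) 0 x
  have hΦ0 (p : ℕ × ℕ × ℕ) (x : K) (hx : x ∉ U p.1) : Φ p x = 0 := by simp [Φ, hw0 _ _ _ hx]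
  have hΦ (k : ℕ) (x : U k) (q : ℕ × ℕ) : Φ (k, q) x = w k q.1 x * φ k q.2 x := by
    simp only [Φ, Subtype.val_injective.extend_apply]
  have hsingle {k : ℕ} {x : K} (hx : x ∈ U k) {g : ℝ → ℝ} (hg : g 0 = 0) {s : ℝ}
      (h : HasSum (fun q : ℕ × ℕ => g (Φ (k, q) x)) s) : HasSum (fun p => g (Φ p x)) s := by
    refine ((Prod.mk_right_injective k).hasSum_iff fun p hp => ?_).1 h
    rw [hΦ0 p x, hg]
    intro hxp
    refine hp ⟨p.2, ?_⟩
    by_contra hne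
    exact (hdisj (i := k) (j := p.1) fun h => hne (by rw [h])).notMem_of_mem_left hx hxp
  have hsums (x : K) : HasSum (fun p => Φ p x) (f x) ∧
      ∃ s ≤ c, HasSum (fun p => |Φ p x|) s := by
    by_cases hx : x ∈ ⋃ j, U j
    · obtain ⟨k, hk⟩ := mem_iUnion.1 hx
      obtain ⟨h₁, h₂⟩ := (hw1 k x hk).mul_prod_of_sum_one (fun m => hwnn k m x) (hs k ⟨x, hk⟩)
      simp only [← hΦ k ⟨x, hk⟩] at h₁ h₂
      rw [hsum] at h₁
      exact ⟨hsingle hk (g := id) rfl h₁, _, hb k ⟨x, hk⟩, hsingle hk (g := abs) abs_zero h₂⟩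
    · have h0 (p : ℕ × ℕ × ℕ) : Φ p x = 0 := hΦ0 p x fun h => hx (mem_iUnion_of_mem _ h)
      simp only [h0, hsupp x hx, abs_zero]
      exact ⟨hasSum_zero, 0, hc, hasSum_zero⟩
  exact .of_hasSum Φ (fun p => continuous_mul_extend_zero (hopen _) (hw _ _) (hw0 _ _)
    (hφ _ _) (hle _ _)) (fun x => (hsums x).1) fun x => (hsums x).2

/-- **Lemma 2.12.** Localization: if `f` vanishes off a disjoint union of open
sets and each restriction has D-norm at most `c`, then `f ∈ DBSC(K)` with
`‖f‖_D ≤ c`. -/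
theorem dnorm_localization {K : Type*} [MetricSpace K]
    [TopologicalSpace.SeparableSpace K] (U : ℕ → Set K)
    (hopen : ∀ j, IsOpen (U j)) (hne : ∀ j, (U j).Nonempty)
    (hdisj : Pairwise fun i j => Disjoint (U i) (U j)) (c : ℝ)
    (f : K → ℝ) (hsupp : ∀ x, x ∉ (⋃ j, U j) → f x = 0)
    (hmem : ∀ j, MemDBSC ((U j).restrict f))
    (hD : ∀ j, DNorm ((U j).restrict f) ≤ c) :
    MemDBSC f ∧ DNorm f ≤ c := by
  have hbound (b : ℝ) (hb : c < b) : DBound f b := by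
    have hr (j : ℕ) : DBound (fun x : U j => f x) b := by
      obtain ⟨a, ha⟩ := (hmem j).exists_dBound
      exact ha.of_dNorm_lt ((hD j).trans_lt hb)
    have : Nonempty (U 0) := (hne 0).to_subtype
    exact .of_restrict hopen hdisj (hr 0).nonneg hsupp hr
  have : Nonempty K := (hne 0).to_type
  exact ⟨(hbound (c + 1) (lt_add_one c)).memDBSC,
    le_of_forall_gt_imp_ge_of_dense fun b hb => (hbound b hb).dNorm_le⟩
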